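/- arXiv:1712.09278 — 8 statements merged into one kernel-verified Lean document; each statement's English description precedes it below -/
import Mathlib

section
/- There is no unitary operator V on ℂ²⊗ℂ² such that (I ⊗ V ⊗ I)(|Φ+⟩_{1,2} ⊗ |Φ+⟩_{3,4}) = |D₄⁽²⁾⟩, where the operator acts as the identity on qubits 1 and 4 and as V on qubits 2 and 3. -/
open scoped BigOperators

/-- Two Bell pairs `|Φ+⟩₁₂ ⊗ |Φ+⟩₃₄` as four-qubit amplitudes; basis: `0 = |H⟩`, `1 = |V⟩`.
Component at `(a,b,c,d)` is `(1/2)·[a = b]·[c = d]`. -/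
noncomputable def bellPairs : Fin 2 × Fin 2 × Fin 2 × Fin 2 → ℂ :=
  fun x => (if x.1 = x.2.1 then 1 else 0) * (if x.2.2.1 = x.2.2.2 then 1 else 0) / 2

/-- Apply a two-qubit operator `V` (a `4 × 4` matrix) to qubits 2 and 3 of a four-qubit
state, acting as the identity on qubits 1 and 4: this is `I ⊗ V ⊗ I`. -/
noncomputable def applyMid (V : Matrix (Fin 2 × Fin 2) (Fin 2 × Fin 2) ℂ)
    (f : Fin 2 × Fin 2 × Fin 2 × Fin 2 → ℂ) : Fin 2 × Fin 2 × Fin 2 × Fin 2 → ℂ :=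
  fun x => ∑ b : Fin 2, ∑ c : Fin 2, V (x.2.1, x.2.2.1) (b, c) * f (x.1, b, c, x.2.2.2)

/-- The symmetric four-qubit Dicke state with two excitations
`|D₄⁽²⁾⟩ = (|HHVV⟩+|HVHV⟩+|VHHV⟩+|HVVH⟩+|VHVH⟩+|VVHH⟩)/√6`. -/
noncomputable def dicke42 : Fin 2 × Fin 2 × Fin 2 × Fin 2 → ℂ :=
  fun x => ((if x = (0, 0, 1, 1) then 1 else 0) + (if x = (0, 1, 0, 1) then 1 else 0)
    + (if x = (1, 0, 0, 1) then 1 else 0) + (if x = (0, 1, 1, 0) then 1 else 0)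
    + (if x = (1, 0, 1, 0) then 1 else 0) + (if x = (1, 1, 0, 0) then 1 else 0))
    / (Real.sqrt 6 : ℂ)

theorem applyMid_bellPairs (V : Matrix (Fin 2 × Fin 2) (Fin 2 × Fin 2) ℂ) (a b c d : Fin 2) :
    applyMid V bellPairs (a, b, c, d) = V (b, c) (a, d) / 2 := by
  simp [applyMid, bellPairs, div_eq_mul_inv]

/-- There is no unitary `V` on `ℂ²⊗ℂ²` with `(I ⊗ V ⊗ I)(|Φ+⟩₁₂ ⊗ |Φ+⟩₃₄) = |D₄⁽²⁾⟩`. -/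
theorem bell_pairs_not_to_dicke :
    ¬ ∃ V ∈ Matrix.unitaryGroup (Fin 2 × Fin 2) ℂ, applyMid V bellPairs = dicke42 := by
  rintro ⟨V, hV, h⟩
  have entry (a b c d : Fin 2) : V (b, c) (a, d) = 2 * dicke42 (a, b, c, d) := by
    rw [← h, applyMid_bellPairs, mul_div_cancel₀ _ two_ne_zero]
  have sqrt_six_sq : (Real.sqrt 6 : ℂ) ^ 2 = 6 := by
    rw [← Complex.ofReal_pow, Real.sq_sqrt (by norm_num)]
    norm_num
  -- The column of `V` at `(0, 0)` has squared norm `2 / 3`.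
  have col := congrFun₂ (Matrix.mem_unitaryGroup_iff'.mp hV) (0, 0) (0, 0)
  simp [Matrix.mul_apply, Matrix.star_apply, Fintype.sum_prod_type, entry, dicke42] at col
  field_simp at col
  rw [sqrt_six_sq] at col
  norm_num at col
end

section
/- Let α_{1H},α_{1V},α_{2H},α_{2V}, β_{1H},β_{1V},β_{2H},β_{2V}, γ_{1H},γ_{1V},γ_{2H},γ_{2V}, η_{1H},η_{1V},η_{2H},η_{2V} be complex numbers each quadruple having squared-modulus sum at most 1, and let s ≥ 0 be a real number. Suppose the four value equations hold: s = β_{1H}α_{2H}+β_{2H}α_{1H} = β_{1H}η_{2V}+β_{2V}η_{1H} = γ_{1V}α_{2H}+γ_{2H}α_{1V} = −(γ_{1V}η_{2V}+γ_{2V}η_{1V}); and the twelve vanishing equations hold: 0 = β_{1H}α_{2V}+β_{2V}α_{1H} = β_{1V}α_{2H}+β_{2H}α_{1V} = β_{1V}α_{2V}+β_{2V}α_{1V} = β_{1H}η_{2H}+β_{2H}η_{1H} = β_{1V}η_{2H}+β_{2H}η_{1V} = β_{1V}η_{2V}+β_{2V}η_{1V} = γ_{1H}α_{2H}+γ_{2H}α_{1H}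 = γ_{1H}α_{2V}+γ_{2V}α_{1H} = γ_{1V}α_{2V}+γ_{2V}α_{1V} = γ_{1H}η_{2H}+γ_{2H}η_{1H} = γ_{1H}η_{2V}+γ_{2V}η_{1H} = γ_{1V}η_{2H}+γ_{2H}η_{1V}. Then s² ≤ 1/9. (This is the optimality bound p_suc ≤ 1/9 for the passive-linear-optical conversion of two Bell pairs into the linear cluster state |C₄⟩.) -/
/-- If `p * x₁ + u * x'`, `p * x₂ + v * x'` and `p * y₂ + v * y'` all vanish, while
`q * x₁ + u * x` and `q * y₂ + v * y` are nonzero and `q * x₂ + v * x = 0`, then `p = 0`. -/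
lemma eq_zero_of_symmetrized_rows {K : Type*} [Field K]
    {p q u v x x' x₁ x₂ y y' y₂ s t : K} (hs : s ≠ 0) (ht : t ≠ 0)
    (hpx₁ : p * x₁ + u * x' = 0) (hpx₂ : p * x₂ + v * x' = 0) (hpy₂ : p * y₂ + v * y' = 0)
    (hqx₁ : q * x₁ + u * x = s) (hqx₂ : q * x₂ + v * x = 0) (hqy₂ : q * y₂ + v * y = t) :
    p = 0 := by
  have hu : p * s = u * (p * x - q * x') := by linear_combination q * hpx₁ - p * hqx₁
  have hv : v * (p * x - q * x') = 0 := by linear_combination p * hqx₂ - q * hpx₂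
  have ht' : p * t = v * (p * y - q * y') := by linear_combination q * hpy₂ - p * hqy₂
  have h : (p * p) * (s * t) = 0 := by
    linear_combination p * t * hu + u * (p * x - q * x') * ht' + u * (p * y - q * y') * hv
  simpa [hs, ht] using h

lemma norm_mul_add_norm_mul_le_one {a x g u : ℂ}
    (h : Complex.normSq a + Complex.normSq x ≤ 1) (h' : Complex.normSq g + Complex.normSq u ≤ 1) :
    ‖g * a‖ + ‖u * x‖ ≤ 1 := by
  simp only [Complex.normSq_eq_norm_sq] at h h'
  rw [norm_mul, norm_mul]
  nlinarith [sq_nonneg (‖a‖ - ‖g‖), sq_nonneg (‖x‖ - ‖u‖)]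

lemma le_one_third_of_opposite_products {a x y g u v : ℂ} {s : ℝ}
    (hax : Complex.normSq a + Complex.normSq x ≤ 1)
    (hay : Complex.normSq a + Complex.normSq y ≤ 1)
    (hgu : Complex.normSq g + Complex.normSq u ≤ 1)
    (hgv : Complex.normSq g + Complex.normSq v ≤ 1)
    (hx : g * a + u * x = s) (hy : g * a + v * y = -s) (hvx : v * x = 0) :
    s ≤ 1 / 3 := by
  have key : ∀ z w : ℂ, z = s ∨ z = -s → w = 2 * s ∨ w = -(2 * s) → ‖z‖ + ‖w‖ ≤ 1 →
      s ≤ 1 / 3 := by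
    rintro z w (rfl | rfl) (rfl | rfl) h <;>
      simp only [norm_neg, norm_mul, Complex.norm_real, Complex.norm_ofNat, Real.norm_eq_abs] at h <;>
      linarith [le_abs_self s]
  rcases mul_eq_zero.mp hvx with rfl | rfl
  · exact key (g * a) (u * x) (.inr (by linear_combination hy))
      (.inl (by linear_combination hx - hy)) (norm_mul_add_norm_mul_le_one hax hgu)
  · exact key (g * a) (v * y) (.inl (by linear_combination hx))
      (.inr (by linear_combination hy - hx)) (norm_mul_add_norm_mul_le_one hay hgv)


/-- Optimality bound `p_suc = s² ≤ 1/9` for passive-linear-optical conversion of two Bell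
pairs into the linear cluster state `|C₄⟩`.  The complex numbers `a__` (α), `b__` (β),
`c__` (γ), `e__` (η) are the restricted matrix elements of the passive linear-optical
unitary, each quadruple having squared-modulus sum at most `1`, and `s = √p_suc`. -/
theorem cluster_psuc_le_one_ninth
    (a1H a1V a2H a2V b1H b1V b2H b2V c1H c1V c2H c2V e1H e1V e2H e2V : ℂ)
    (ha : Complex.normSq a1H + Complex.normSq a1V + Complex.normSq a2H + Complex.normSq a2V ≤ 1)
    (hb : Complex.normSq b1H + Complex.normSq b1V + Complex.normSq b2H + Complex.normSq b2V ≤ 1)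
    (hc : Complex.normSq c1H + Complex.normSq c1V + Complex.normSq c2H + Complex.normSq c2V ≤ 1)
    (he : Complex.normSq e1H + Complex.normSq e1V + Complex.normSq e2H + Complex.normSq e2V ≤ 1)
    (s : ℝ) (hs : 0 ≤ s)
    (h1 : (s : ℂ) = b1H * a2H + b2H * a1H)
    (h2 : (s : ℂ) = b1H * e2V + b2V * e1H)
    (h3 : (s : ℂ) = c1V * a2H + c2H * a1V)
    (h4 : (s : ℂ) = -(c1V * e2V + c2V * e1V))
    (z1 : b1H * a2V + b2V * a1H = 0)
    (z2 : b1V * a2H + b2H * a1V = 0)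
    (z3 : b1V * a2V + b2V * a1V = 0)
    (z4 : b1H * e2H + b2H * e1H = 0)
    (z5 : b1V * e2H + b2H * e1V = 0)
    (z6 : b1V * e2V + b2V * e1V = 0)
    (z7 : c1H * a2H + c2H * a1H = 0)
    (z8 : c1H * a2V + c2V * a1H = 0)
    (z9 : c1V * a2V + c2V * a1V = 0)
    (z10 : c1H * e2H + c2H * e1H = 0)
    (z11 : c1H * e2V + c2V * e1H = 0)
    (z12 : c1V * e2H + c2H * e1V = 0) :
    s ^ 2 ≤ 1 / 9 := by
  rcases hs.eq_or_lt with rfl | hpos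
  · norm_num
  have hs0 : (s : ℂ) ≠ 0 := by exact_mod_cast hpos.ne'
  have hb1V : b1V = 0 := eq_zero_of_symmetrized_rows hs0 hs0 z2 z3 z6 h1.symm z1 h2.symm
  have hc1H : c1H = 0 := eq_zero_of_symmetrized_rows (y := e1V) hs0 (neg_ne_zero.mpr hs0)
    z7 z8 z11 h3.symm z9 (by linear_combination h4)
  have ha2V : a2V = 0 := eq_zero_of_symmetrized_rows
    (u := a1H) (v := a1V) (x' := b2V) (y' := c2V) (x₁ := b1H) (x₂ := b1V) (y₂ := c1V)
    (q := a2H) (x := b2H) (y := c2H) hs0 hs0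
    (by linear_combination z1) (by linear_combination z3) (by linear_combination z9)
    (by linear_combination -h1) (by linear_combination z2) (by linear_combination -h3)
  subst hb1V hc1H ha2V
  have na1H := Complex.normSq_nonneg a1H
  have na1V := Complex.normSq_nonneg a1V
  have nb2H := Complex.normSq_nonneg b2H
  have nb2V := Complex.normSq_nonneg b2V
  have nc2H := Complex.normSq_nonneg c2H
  have nc2V := Complex.normSq_nonneg c2V
  have ne1H := Complex.normSq_nonneg e1H
  have ne1V := Complex.normSq_nonneg e1V
  have ne2H := Complex.normSq_nonneg e2H
  suffices s ≤ 1 / 3 by nlinarith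
  simp only [zero_mul, mul_zero, zero_add, map_zero, add_zero] at *
  by_cases hcol : a1V = 0 ∧ e1V = 0
  · obtain ⟨rfl, rfl⟩ := hcol
    have hc1V : c1V ≠ 0 := by rintro rfl; simp [hpos.ne'] at h3
    have he2V : e2V = -a2H := mul_left_cancel₀ hc1V (by linear_combination -h3 + h4)
    subst he2V
    rw [Complex.normSq_neg] at he
    refine le_one_third_of_opposite_products (a := a2H) (x := a1H) (y := e1H) (g := b1H)
      (u := b2H) (v := -b2V) (by linarith) (by linarith) (by linarith)
      (by rw [Complex.normSq_neg]; linarith) h1.symm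
      (by linear_combination h2) (by linear_combination -z1)
  · obtain ⟨rfl, rfl⟩ : b2H = 0 ∧ b2V = 0 := by
      simp only [mul_eq_zero] at z2 z3 z5 z6
      tauto
    have hb1H : b1H ≠ 0 := by rintro rfl; simp [hpos.ne'] at h1
    have he2V : e2V = a2H := mul_left_cancel₀ hb1H (by linear_combination h1 - h2)
    subst he2V
    exact le_one_third_of_opposite_products (a := e2V) (x := a1V) (y := e1V) (g := c1V)
      (u := c2H) (v := c2V) (by linarith) (by linarith) (by linarith) (by linarith) h3.symm
      (by linear_combination h4) z9
end

section
/- Let α_{js}, β_{js}, γ_{js}, η_{js} (j∈{1,2}, s∈{H,V}) be complex numbers, each quadruple having squared-modulus sum at most 1, and let s ≥ 0 be a real number. Suppose s = β_{1H}α_{2H}+β_{2H}α_{1H} = γ_{1V}η_{2V}+γ_{2V}η_{1V}, and the following fourteen expressions all vanish: β_{1H}α_{2V}+β_{2V}α_{1H}, β_{1V}α_{2H}+β_{2H}α_{1V}, β_{1V}α_{2V}+β_{2V}α_{1V}, β_{1H}η_{2H}+β_{2H}η_{1H}, β_{1H}η_{2V}+β_{2V}η_{1H}, β_{1V}η_{2H}+β_{2H}η_{1V},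 β_{1V}η_{2V}+β_{2V}η_{1V}, γ_{1H}α_{2H}+γ_{2H}α_{1H}, γ_{1H}α_{2V}+γ_{2V}α_{1H}, γ_{1V}α_{2H}+γ_{2H}α_{1V}, γ_{1V}α_{2V}+γ_{2V}α_{1V}, γ_{1H}η_{2H}+γ_{2H}η_{1H}, γ_{1H}η_{2V}+γ_{2V}η_{1H}, γ_{1V}η_{2H}+γ_{2H}η_{1V}. Then s ≤ 1. (Since s = √(2·p_suc), this is the optimality bound p_suc ≤ 1/2 for conversion of two Bell pairs into the GHZ state |GHZ₄⟩ by passive linear optics and postselection.) -/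
/-- Optimality bound for passive-linear-optical conversion of two Bell pairs into the GHZ
state `|GHZ₄⟩`: here `s = √(2·p_suc)`, so `s ≤ 1` is the bound `p_suc ≤ 1/2`.  The complex
numbers `a__` (α), `b__` (β), `c__` (γ), `e__` (η) are the restricted matrix elements of the
passive linear-optical unitary, each quadruple having squared-modulus sum at most `1`. -/
theorem ghz_psuc_le_one_half
    (a1H a1V a2H a2V b1H b1V b2H b2V c1H c1V c2H c2V e1H e1V e2H e2V : ℂ)
    (ha : Complex.normSq a1H + Complex.normSq a1V + Complex.normSq a2H + Complex.normSq a2V ≤ 1)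
    (hb : Complex.normSq b1H + Complex.normSq b1V + Complex.normSq b2H + Complex.normSq b2V ≤ 1)
    (hc : Complex.normSq c1H + Complex.normSq c1V + Complex.normSq c2H + Complex.normSq c2V ≤ 1)
    (he : Complex.normSq e1H + Complex.normSq e1V + Complex.normSq e2H + Complex.normSq e2V ≤ 1)
    (s : ℝ) (hs : 0 ≤ s)
    (h1 : (s : ℂ) = b1H * a2H + b2H * a1H)
    (h2 : (s : ℂ) = c1V * e2V + c2V * e1V)
    (z1 : b1H * a2V + b2V * a1H = 0)
    (z2 : b1V * a2H + b2H * a1V = 0)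
    (z3 : b1V * a2V + b2V * a1V = 0)
    (z4 : b1H * e2H + b2H * e1H = 0)
    (z5 : b1H * e2V + b2V * e1H = 0)
    (z6 : b1V * e2H + b2H * e1V = 0)
    (z7 : b1V * e2V + b2V * e1V = 0)
    (z8 : c1H * a2H + c2H * a1H = 0)
    (z9 : c1H * a2V + c2V * a1H = 0)
    (z10 : c1V * a2H + c2H * a1V = 0)
    (z11 : c1V * a2V + c2V * a1V = 0)
    (z12 : c1H * e2H + c2H * e1H = 0)
    (z13 : c1H * e2V + c2V * e1H = 0)
    (z14 : c1V * e2H + c2H * e1V = 0) :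
    s ≤ 1 := by
  have h : s ≤ ‖b1H‖ * ‖a2H‖ + ‖b2H‖ * ‖a1H‖ := by
    calc s = ‖(s : ℂ)‖ := by rw [Complex.norm_real, Real.norm_of_nonneg hs]
      _ ≤ ‖b1H * a2H‖ + ‖b2H * a1H‖ := h1 ▸ norm_add_le _ _
      _ = ‖b1H‖ * ‖a2H‖ + ‖b2H‖ * ‖a1H‖ := by rw [norm_mul, norm_mul]
  simp only [Complex.normSq_eq_norm_sq] at ha hb
  linarith [two_mul_le_add_sq ‖b1H‖ ‖a2H‖, two_mul_le_add_sq ‖b2H‖ ‖a1H‖,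
    sq_nonneg ‖a1V‖, sq_nonneg ‖a2V‖, sq_nonneg ‖b1V‖, sq_nonneg ‖b2V‖]
end

section
/- Let α_{js}, β_{js}, γ_{js}, η_{js} (j∈{1,2}, s∈{H,V}) be complex numbers, each quadruple having squared-modulus sum at most 1, and let s ≥ 0 be a real number. Suppose s = β_{1H}α_{2V}+β_{2V}α_{1H} = β_{1V}α_{2H}+β_{2H}α_{1V} = β_{1H}η_{2H}+β_{2H}η_{1H} = γ_{1H}α_{2H}+γ_{2H}α_{1H}, and the following twelve expressions all vanish: β_{1H}α_{2H}+β_{2H}α_{1H}, β_{1V}α_{2V}+β_{2V}α_{1V}, β_{1H}η_{2V}+β_{2V}η_{1H}, β_{1V}η_{2H}+β_{2H}η_{1V}, β_{1V}η_{2V}+β_{2V}η_{1V}, γ_{1H}α_{2V}+γ_{2V}α_{1H}, γ_{1V}α_{2H}+γ_{2H}α_{1V}, γ_{1V}α_{2V}+γ_{2V}α_{1V}, γ_{1H}η_{2H}+γ_{2H}η_{1H}, γ_{1H}η_{2V}+γ_{2V}η_{1H}, γ_{1V}η_{2H}+γ_{2H}η_{1V}, γ_{1V}η_{2V}+γ_{2V}η_{1V}.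 Then s = 0. (This shows the success probability of converting two Bell pairs into the W state |W₄⟩ by passive linear optics and postselection is zero.) -/
/-- The success probability of converting two Bell pairs into the W state `|W₄⟩` by passive
linear optics and postselection is zero: under the listed constraints, `s = √p_suc = 0`.
The complex numbers `a__` (α), `b__` (β), `c__` (γ), `e__` (η) are the restricted matrix
elements of the passive linear-optical unitary, each quadruple having squared-modulus sum
at most `1`. -/
theorem w4_psuc_eq_zero
    (a1H a1V a2H a2V b1H b1V b2H b2V c1H c1V c2H c2V e1H e1V e2H e2V : ℂ)
    (ha : Complex.normSq a1H + Complex.normSq a1V + Complex.normSq a2H + Complex.normSq a2V ≤ 1)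
    (hb : Complex.normSq b1H + Complex.normSq b1V + Complex.normSq b2H + Complex.normSq b2V ≤ 1)
    (hc : Complex.normSq c1H + Complex.normSq c1V + Complex.normSq c2H + Complex.normSq c2V ≤ 1)
    (he : Complex.normSq e1H + Complex.normSq e1V + Complex.normSq e2H + Complex.normSq e2V ≤ 1)
    (s : ℝ) (hs : 0 ≤ s)
    (h1 : (s : ℂ) = b1H * a2V + b2V * a1H)
    (h2 : (s : ℂ) = b1V * a2H + b2H * a1V)
    (h3 : (s : ℂ) = b1H * e2H + b2H * e1H)
    (h4 : (s : ℂ) = c1H * a2H + c2H * a1H)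
    (z1 : b1H * a2H + b2H * a1H = 0)
    (z2 : b1V * a2V + b2V * a1V = 0)
    (z3 : b1H * e2V + b2V * e1H = 0)
    (z4 : b1V * e2H + b2H * e1V = 0)
    (z5 : b1V * e2V + b2V * e1V = 0)
    (z6 : c1H * a2V + c2V * a1H = 0)
    (z7 : c1V * a2H + c2H * a1V = 0)
    (z8 : c1V * a2V + c2V * a1V = 0)
    (z9 : c1H * e2H + c2H * e1H = 0)
    (z10 : c1H * e2V + c2V * e1H = 0)
    (z11 : c1V * e2H + c2H * e1V = 0)
    (z12 : c1V * e2V + c2V * e1V = 0) :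
    s = 0 := by
  by_contra hne
  have hsC : (s : ℂ) ≠ 0 := Complex.ofReal_ne_zero.mpr hne
  -- The matrix of `β` against `α` is `s` times the swap, so its determinant is `-s²`.
  have hdet : (b1H * a1V - b1V * a1H) * (a2H * b2V - a2V * b2H) = -(s : ℂ) ^ 2 := by
    linear_combination (b1V * a2V + b2V * a1V) * z1 + (s : ℂ) * h1
      + (b1H * a2V + b2V * a1H) * h2
  have hu : a2H * b2V - a2V * b2H ≠ 0 := by
    intro h
    rw [h, mul_zero] at hdet
    exact pow_ne_zero 2 hsC (neg_eq_zero.mp hdet.symm)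
  -- Determinants of the pencils obtained by adding multiples of `η` to `α`, or of `γ` to `β`.
  have hbe : (b1H * e1V - b1V * e1H) * (e2H * b2V - e2V * b2H) = 0 := by
    linear_combination (b1H * e2H + b2H * e1H) * z5 - (b1H * e2V + b2V * e1H) * z4
  have hbe' : (b1H * e1V - b1V * e1H) * (a2H * b2V - a2V * b2H)
      + (b1H * a1V - b1V * a1H) * (e2H * b2V - e2V * b2H) = 0 := by
    linear_combination (b1H * e2H + b2H * e1H) * z2 + (b1V * e2V + b2V * e1V) * z1
      - (b1H * a2V + b2V * a1H) * z4 - (b1V * a2H + b2H * a1V) * z3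
  have hca : (c1H * a1V - c1V * a1H) * (a2H * c2V - a2V * c2H) = 0 := by
    linear_combination (c1H * a2H + c2H * a1H) * z8 - (c1H * a2V + c2V * a1H) * z7
  have hca' : (c1H * a1V - c1V * a1H) * (a2H * b2V - a2V * b2H)
      + (b1H * a1V - b1V * a1H) * (a2H * c2V - a2V * c2H) = 0 := by
    linear_combination (c1H * a2H + c2H * a1H) * z2 + (c1V * a2V + c2V * a1V) * z1
      - (b1H * a2V + b2V * a1H) * z7 - (b1V * a2H + b2H * a1V) * z6
  have hp : b1H * e1V - b1V * e1H = 0 := by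
    have h : (b1H * e1V - b1V * e1H) ^ 2 * (a2H * b2V - a2V * b2H) = 0 := by
      linear_combination (b1H * e1V - b1V * e1H) * hbe' - (b1H * a1V - b1V * a1H) * hbe
    exact pow_eq_zero_iff two_ne_zero |>.mp ((mul_eq_zero.mp h).resolve_right hu)
  have hr : c1H * a1V - c1V * a1H = 0 := by
    have h : (c1H * a1V - c1V * a1H) ^ 2 * (a2H * b2V - a2V * b2H) = 0 := by
      linear_combination (c1H * a1V - c1V * a1H) * hca' - (b1H * a1V - b1V * a1H) * hca
    exact pow_eq_zero_iff two_ne_zero |>.mp ((mul_eq_zero.mp h).resolve_right hu)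
  have hb1V : b1V = 0 := by
    have h : (s : ℂ) * b1V = 0 := by
      linear_combination b1V * h3 + b1H * z4 - b2H * hp
    exact (mul_eq_zero.mp h).resolve_left hsC
  have ha1V : a1V = 0 := by
    have h : (s : ℂ) * a1V = 0 := by
      linear_combination a1V * h4 + a1H * z7 + a2H * hr
    exact (mul_eq_zero.mp h).resolve_left hsC
  apply hsC
  rw [h2, hb1V, ha1V]
  ring
end

section
/- Let α_{1H},α_{1V},α_{2H},α_{2V} and β_{1H},β_{1V},β_{2H},β_{2V} be complex numbers with |α_{1H}|²+|α_{1V}|²+|α_{2H}|²+|α_{2V}|² ≤ 1 and |β_{1H}|²+|β_{1V}|²+|β_{2H}|²+|β_{2V}|² ≤ 1, and let s ≥ 0 be a real number with s = β_{1H}α_{2H}+β_{2H}α_{1H} = β_{1V}α_{2V}+β_{2V}α_{1V}. Then s ≤ 1/2. (This is the optimality bound p_suc = s² ≤ 1/4 for converting two Bell pairs |Φ+⟩_{1,2}⊗|Φ+⟩_{3,4} into |Φ+⟩_{1,4}⊗|Φ+⟩_{2,3} by passive linear optics and postselection.) -/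
theorem Complex.two_mul_re_mul_le (z w : ℂ) :
    2 * (z * w).re ≤ Complex.normSq z + Complex.normSq w := by
  rw [Complex.mul_re, Complex.normSq_apply, Complex.normSq_apply]
  nlinarith [sq_nonneg (z.re - w.re), sq_nonneg (z.im + w.im)]

/-- Optimality bound `p_suc = s² ≤ 1/4` (i.e. `s ≤ 1/2`) for converting two Bell pairs
`|Φ+⟩₁₂ ⊗ |Φ+⟩₃₄` into `|Φ+⟩₁₄ ⊗ |Φ+⟩₂₃` by passive linear optics and postselection.
The complex numbers `a__` (α) and `b__` (β) are the restricted matrix elements of the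
passive linear-optical unitary, each quadruple having squared-modulus sum at most `1`,
and `s = √p_suc`. -/
theorem bell14_23_psuc_le_one_quarter
    (a1H a1V a2H a2V b1H b1V b2H b2V : ℂ)
    (ha : Complex.normSq a1H + Complex.normSq a1V + Complex.normSq a2H + Complex.normSq a2V ≤ 1)
    (hb : Complex.normSq b1H + Complex.normSq b1V + Complex.normSq b2H + Complex.normSq b2V ≤ 1)
    (s : ℝ) (hs : 0 ≤ s)
    (h1 : (s : ℂ) = b1H * a2H + b2H * a1H)
    (h2 : (s : ℂ) = b1V * a2V + b2V * a1V) :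
    s ≤ 1 / 2 := by
  have h1re := congrArg Complex.re h1
  have h2re := congrArg Complex.re h2
  rw [Complex.ofReal_re, Complex.add_re] at h1re h2re
  linarith [Complex.two_mul_re_mul_le b1H a2H, Complex.two_mul_re_mul_le b2H a1H,
    Complex.two_mul_re_mul_le b1V a2V, Complex.two_mul_re_mul_le b2V a1V]
end

section
/- Let α_{js}, β_{js}, γ_{js}, η_{js} (j∈{1,2}, s∈{H,V}) be complex numbers, each quadruple having squared-modulus sum at most 1, and let s ≥ 0 be a real number. Suppose s = β_{1H}α_{2H}+β_{2H}α_{1H} = β_{1V}α_{2V}+β_{2V}α_{1V} = −(β_{1H}η_{2V}+β_{2V}η_{1H}) = −(β_{1V}η_{2H}+β_{2H}η_{1V}) = γ_{1H}α_{2V}+γ_{2V}α_{1H} = γ_{1V}α_{2H}+γ_{2H}α_{1V} = γ_{1H}η_{2H}+γ_{2H}η_{1H} = γ_{1V}η_{2V}+γ_{2V}η_{1V}, and the following eight expressions all vanish: β_{1H}α_{2V}+β_{2V}α_{1H}, β_{1V}α_{2H}+β_{2H}α_{1V}, β_{1H}η_{2H}+β_{2H}η_{1H}, β_{1V}η_{2V}+β_{2V}η_{1V},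 γ_{1H}α_{2H}+γ_{2H}α_{1H}, γ_{1V}α_{2V}+γ_{2V}α_{1V}, γ_{1H}η_{2V}+γ_{2V}η_{1H}, γ_{1V}η_{2H}+γ_{2H}η_{1V}. Then s = 0. (This shows the success probability of converting two Bell pairs into the χ state by passive linear optics and postselection is zero.) -/
/-- If the `2 × 2` matrices with rows `(p, q), (r, t)` and `(k, l), (m, n)` multiply to a nonzero
scalar matrix, then so do they in the opposite order. -/
theorem two_by_two_mul_comm_of_eq_scalar {K : Type*} [Field K] {p q r t k l m n s : K}
    (hs : s ≠ 0) (h11 : s = p * k + q * m) (h12 : p * l + q * n = 0)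
    (h21 : r * k + t * m = 0) (h22 : s = r * l + t * n) :
    k * p + l * r = s ∧ k * q + l * t = 0 ∧ m * p + n * r = 0 ∧ m * q + n * t = s := by
  have hd : p * t - q * r ≠ 0 := by
    intro h
    have : s ^ 2 = 0 := by
      linear_combination s * h11 + (p * k + q * m) * h22 + (r * k + t * m) * h12 +
        (k * n - l * m) * h
    exact hs (pow_eq_zero_iff two_ne_zero |>.1 this)
  have hk : (p * t - q * r) * k = s * t := by linear_combination (-t) * h11 - q * h21
  have hl : (p * t - q * r) * l = -(s * q) := by linear_combination t * h12 + q * h22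
  have hm : (p * t - q * r) * m = -(s * r) := by linear_combination r * h11 + p * h21
  have hn : (p * t - q * r) * n = s * p := by linear_combination (-r) * h12 - p * h22
  refine ⟨mul_left_cancel₀ hd ?_, mul_left_cancel₀ hd ?_, mul_left_cancel₀ hd ?_,
    mul_left_cancel₀ hd ?_⟩
  · linear_combination p * hk + r * hl
  · linear_combination q * hk + t * hl
  · linear_combination p * hm + r * hn
  · linear_combination q * hm + t * hn

/-- If a vector `(y, y')` is orthogonal to both a vector `(x, x')` and its swap `(x', x)`, then in
the eigenbasis of the swap the two vectors have disjoint supports. -/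
theorem add_mul_add_and_sub_mul_sub_eq_zero {R : Type*} [CommRing R] {x x' y y' : R}
    (h : y * x + y' * x' = 0) (h' : y' * x + y * x' = 0) :
    (y + y') * (x + x') = 0 ∧ (y - y') * (x - x') = 0 :=
  ⟨by linear_combination h + h', by linear_combination h - h'⟩


/-- The success probability of converting two Bell pairs into the χ state by passive linear
optics and postselection is zero: under the listed constraints, `s = √(p_suc/2) = 0`.
The complex numbers `a__` (α), `b__` (β), `c__` (γ), `e__` (η) are the restricted matrix
elements of the passive linear-optical unitary, each quadruple having squared-modulus sum
at most `1`. -/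
theorem chi_psuc_eq_zero
    (a1H a1V a2H a2V b1H b1V b2H b2V c1H c1V c2H c2V e1H e1V e2H e2V : ℂ)
    (ha : Complex.normSq a1H + Complex.normSq a1V + Complex.normSq a2H + Complex.normSq a2V ≤ 1)
    (hb : Complex.normSq b1H + Complex.normSq b1V + Complex.normSq b2H + Complex.normSq b2V ≤ 1)
    (hc : Complex.normSq c1H + Complex.normSq c1V + Complex.normSq c2H + Complex.normSq c2V ≤ 1)
    (he : Complex.normSq e1H + Complex.normSq e1V + Complex.normSq e2H + Complex.normSq e2V ≤ 1)
    (s : ℝ) (hs : 0 ≤ s)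
    (h1 : (s : ℂ) = b1H * a2H + b2H * a1H)
    (h2 : (s : ℂ) = b1V * a2V + b2V * a1V)
    (h3 : (s : ℂ) = -(b1H * e2V + b2V * e1H))
    (h4 : (s : ℂ) = -(b1V * e2H + b2H * e1V))
    (h5 : (s : ℂ) = c1H * a2V + c2V * a1H)
    (h6 : (s : ℂ) = c1V * a2H + c2H * a1V)
    (h7 : (s : ℂ) = c1H * e2H + c2H * e1H)
    (h8 : (s : ℂ) = c1V * e2V + c2V * e1V)
    (z1 : b1H * a2V + b2V * a1H = 0)
    (z2 : b1V * a2H + b2H * a1V = 0)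
    (z3 : b1H * e2H + b2H * e1H = 0)
    (z4 : b1V * e2V + b2V * e1V = 0)
    (z5 : c1H * a2H + c2H * a1H = 0)
    (z6 : c1V * a2V + c2V * a1V = 0)
    (z7 : c1H * e2V + c2V * e1H = 0)
    (z8 : c1V * e2H + c2H * e1V = 0) :
    s = 0 := by
  by_contra hs0
  have hS : (s : ℂ) ≠ 0 := by exact_mod_cast hs0
  obtain ⟨ab, aa, bb, ba⟩ := two_by_two_mul_comm_of_eq_scalar (p := b1H) (q := a1H) (r := b1V)
    (t := a1V) (k := a2H) (l := a2V) (m := b2H) (n := b2V) hS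
    (by linear_combination h1) (by linear_combination z1) (by linear_combination z2)
    (by linear_combination h2)
  obtain ⟨eb, ee, bb', be⟩ := two_by_two_mul_comm_of_eq_scalar (p := b1H) (q := e1H) (r := b1V)
    (t := e1V) (k := e2V) (l := e2H) (m := b2V) (n := b2H) (neg_ne_zero.2 hS)
    (by linear_combination -h3) (by linear_combination z3) (by linear_combination z4)
    (by linear_combination -h4)
  obtain ⟨ac, aa', cc, ca⟩ := two_by_two_mul_comm_of_eq_scalar (p := c1H) (q := a1H) (r := c1V)
    (t := a1V) (k := a2V) (l := a2H) (m := c2V) (n := c2H) hS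
    (by linear_combination h5) (by linear_combination z5) (by linear_combination z6)
    (by linear_combination h6)
  obtain ⟨ec, ee', cc', ce⟩ := two_by_two_mul_comm_of_eq_scalar (p := c1H) (q := e1H) (r := c1V)
    (t := e1V) (k := e2H) (l := e2V) (m := c2H) (n := c2V) hS
    (by linear_combination h7) (by linear_combination z7) (by linear_combination z8)
    (by linear_combination h8)
  obtain ⟨ap, am⟩ := add_mul_add_and_sub_mul_sub_eq_zero aa aa'
  obtain ⟨bp, bm⟩ := add_mul_add_and_sub_mul_sub_eq_zero bb bb'
  obtain ⟨cp, cm⟩ := add_mul_add_and_sub_mul_sub_eq_zero cc' cc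
  rcases mul_eq_zero.1 ap with ap | ap <;> rcases mul_eq_zero.1 am with am | am <;>
  rcases mul_eq_zero.1 bp with bp | bp <;> rcases mul_eq_zero.1 bm with bm | bm <;>
  rcases mul_eq_zero.1 cp with cp | cp <;> rcases mul_eq_zero.1 cm with cm | cm <;>
  grind
end

section
/- There exists a unitary 4×4 complex matrix M, with rows and columns indexed by the four mode–polarization pairs (1,H),(1,V),(2,H),(2,V), such that, writing β_{js} = M_{(j,s),(1,H)}, γ_{js} = M_{(j,s),(1,V)}, α_{js} = M_{(j,s),(2,H)}, η_{js} = M_{(j,s),(2,V)}, the following hold with s = 1/2: s = β_{1H}α_{2H}+β_{2H}α_{1H} = β_{1V}α_{2V}+β_{2V}α_{1V} = γ_{1H}η_{2H}+γ_{2H}η_{1H} = γ_{1V}η_{2V}+γ_{2V}η_{1V}; 0 = β_{1H}α_{2V}+β_{2V}α_{1H} = β_{1V}α_{2H}+β_{2H}α_{1V} = γ_{1H}η_{2V}+γ_{2V}η_{1H} = γ_{1V}η_{2H}+γ_{2H}η_{1V}; and all eight mixed β–η and γ–α expressions vanish: β_{1H}η_{2H}+β_{2H}η_{1H}, β_{1H}η_{2V}+β_{2V}η_{1H},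 β_{1V}η_{2H}+β_{2H}η_{1V}, β_{1V}η_{2V}+β_{2V}η_{1V}, γ_{1H}α_{2H}+γ_{2H}α_{1H}, γ_{1H}α_{2V}+γ_{2V}α_{1H}, γ_{1V}α_{2H}+γ_{2H}α_{1V}, γ_{1V}α_{2V}+γ_{2V}α_{1V}. (This shows the optimal success probability 1/4 for conversion of two Bell pairs |Φ+⟩_{1,2}⊗|Φ+⟩_{3,4} into |Φ+⟩_{1,4}⊗|Φ+⟩_{2,3} is achievable by a passive linear-optical network with two spatial modes.) -/
/-!
A passive linear-optical network with two spatial modes and two polarizations is described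
by a unitary `4 × 4` complex matrix `M`, with rows and columns indexed by mode–polarization
pairs in `Fin 2 × Fin 2`: the pair `(j, s)` stands for spatial mode `j + 1` with
polarization `H` if `s = 0` and `V` if `s = 1`.  Following the paper, the entries
`β_{js} = M (j-1, s) (0, 0)`, `γ_{js} = M (j-1, s) (0, 1)`, `α_{js} = M (j-1, s) (1, 0)`,
`η_{js} = M (j-1, s) (1, 1)` give the output amplitudes of input photons in the modes
`(1,H)`, `(1,V)`, `(2,H)`, `(2,V)` respectively.
-/

/-- A passive two-mode network acting as a balanced beam splitter up to permutations and signs. -/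
noncomputable def bellConversionMatrix : Matrix (Fin 2 × Fin 2) (Fin 2 × Fin 2) ℂ :=
  Matrix.of fun p q => ((√2)⁻¹ : ℝ) *
    ![![![![1, 0], ![0, -1]], ![![0, 1], ![1, 0]]],
      ![![![0, -1], ![1, 0]], ![![1, 0], ![0, 1]]]] p.1 p.2 q.1 q.2

lemma inv_sqrt_two_mul_self : (((√2)⁻¹ : ℝ) : ℂ) * ((√2)⁻¹ : ℝ) = 1 / 2 := by
  rw [← Complex.ofReal_mul, ← mul_inv, Real.mul_self_sqrt (by norm_num)]
  norm_num

lemma bellConversionMatrix_mem_unitaryGroup :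
    bellConversionMatrix ∈ Matrix.unitaryGroup (Fin 2 × Fin 2) ℂ := by
  have h := inv_sqrt_two_mul_self
  rw [Matrix.mem_unitaryGroup_iff]
  ext ⟨i, j⟩ ⟨k, l⟩
  simp only [Matrix.mul_apply, Matrix.star_apply, Fintype.sum_prod_type, Fin.sum_univ_two,
    bellConversionMatrix, Matrix.of_apply, star_mul', RCLike.star_def, Complex.conj_ofReal]
  generalize (((√2)⁻¹ : ℝ) : ℂ) = r at h ⊢
  fin_cases i <;> fin_cases j <;> fin_cases k <;> fin_cases l <;>
    simp [h] <;> norm_num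

/-- The optimal success probability `1/4` for conversion of two Bell pairs
`|Φ+⟩₁₂ ⊗ |Φ+⟩₃₄` into `|Φ+⟩₁₄ ⊗ |Φ+⟩₂₃` is achievable by a passive linear-optical
network with two spatial modes: there is a unitary `M` satisfying all conversion equations
with `s = 1/2`. -/
theorem bell14_23_psuc_one_quarter_achievable :
    ∃ M ∈ Matrix.unitaryGroup (Fin 2 × Fin 2) ℂ,
      M (0, 0) (0, 0) * M (1, 0) (1, 0) + M (1, 0) (0, 0) * M (0, 0) (1, 0) = (1 / 2 : ℂ) ∧
      M (0, 1) (0, 0) * M (1, 1) (1, 0) + M (1, 1) (0, 0) * M (0, 1) (1, 0) = (1 / 2 : ℂ) ∧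
      M (0, 0) (0, 1) * M (1, 0) (1, 1) + M (1, 0) (0, 1) * M (0, 0) (1, 1) = (1 / 2 : ℂ) ∧
      M (0, 1) (0, 1) * M (1, 1) (1, 1) + M (1, 1) (0, 1) * M (0, 1) (1, 1) = (1 / 2 : ℂ) ∧
      M (0, 0) (0, 0) * M (1, 1) (1, 0) + M (1, 1) (0, 0) * M (0, 0) (1, 0) = 0 ∧
      M (0, 1) (0, 0) * M (1, 0) (1, 0) + M (1, 0) (0, 0) * M (0, 1) (1, 0) = 0 ∧
      M (0, 0) (0, 1) * M (1, 1) (1, 1) + M (1, 1) (0, 1) * M (0, 0) (1, 1) = 0 ∧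
      M (0, 1) (0, 1) * M (1, 0) (1, 1) + M (1, 0) (0, 1) * M (0, 1) (1, 1) = 0 ∧
      M (0, 0) (0, 0) * M (1, 0) (1, 1) + M (1, 0) (0, 0) * M (0, 0) (1, 1) = 0 ∧
      M (0, 0) (0, 0) * M (1, 1) (1, 1) + M (1, 1) (0, 0) * M (0, 0) (1, 1) = 0 ∧
      M (0, 1) (0, 0) * M (1, 0) (1, 1) + M (1, 0) (0, 0) * M (0, 1) (1, 1) = 0 ∧
      M (0, 1) (0, 0) * M (1, 1) (1, 1) + M (1, 1) (0, 0) * M (0, 1) (1, 1) = 0 ∧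
      M (0, 0) (0, 1) * M (1, 0) (1, 0) + M (1, 0) (0, 1) * M (0, 0) (1, 0) = 0 ∧
      M (0, 0) (0, 1) * M (1, 1) (1, 0) + M (1, 1) (0, 1) * M (0, 0) (1, 0) = 0 ∧
      M (0, 1) (0, 1) * M (1, 0) (1, 0) + M (1, 0) (0, 1) * M (0, 1) (1, 0) = 0 ∧
      M (0, 1) (0, 1) * M (1, 1) (1, 0) + M (1, 1) (0, 1) * M (0, 1) (1, 0) = 0 := by
  have h := inv_sqrt_two_mul_self
  refine ⟨bellConversionMatrix, bellConversionMatrix_mem_unitaryGroup, ?_⟩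
  simp only [bellConversionMatrix, Matrix.of_apply]
  generalize (((√2)⁻¹ : ℝ) : ℂ) = r at h ⊢
  simp [h]
end

section
/- For every real ε > 0, one has (2ε² + 16ε + 2 − 2(1+ε)·√(ε² + 14ε + 1)) / (36ε) ≤ 1/9, with equality when ε = 1. -/
/-- The maximization step for the optimal success probability `1/9` of passive
linear-optical conversion of two Bell pairs into the four-qubit linear cluster state:
for every `ε > 0`,
`(2ε² + 16ε + 2 − 2(1+ε)·√(ε² + 14ε + 1)) / (36ε) ≤ 1/9`, with equality at `ε = 1`. -/
theorem cluster_max_step :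
    (∀ ε : ℝ, 0 < ε →
      (2 * ε ^ 2 + 16 * ε + 2 - 2 * (1 + ε) * Real.sqrt (ε ^ 2 + 14 * ε + 1)) / (36 * ε)
        ≤ 1 / 9) ∧
    (2 * (1 : ℝ) ^ 2 + 16 * 1 + 2 - 2 * (1 + 1) * Real.sqrt ((1 : ℝ) ^ 2 + 14 * 1 + 1))
        / (36 * 1) = 1 / 9 := by
  constructor
  · intro ε hε
    have key : (ε ^ 2 + 6 * ε + 1) / (1 + ε) ≤ Real.sqrt (ε ^ 2 + 14 * ε + 1) := by
      apply Real.le_sqrt_of_sq_le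
      rw [div_pow, div_le_iff₀ (by positivity)]
      have h : 0 ≤ 4 * ε * (ε - 1) ^ 2 := by positivity
      linarith
    rw [div_le_iff₀ (by positivity)] at key
    rw [div_le_iff₀ (by positivity)]
    linarith
  · have h : Real.sqrt ((1 : ℝ) ^ 2 + 14 * 1 + 1) = 4 := by
      rw [Real.sqrt_eq_iff_mul_self_eq_of_pos (by norm_num)]
      norm_num
    rw [h]
    norm_num
end
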